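/- Under the MCI setup with H_n invertible for every n ∈ I_1, let f : ℝ → ℂ be 2π-periodic and square-integrable on [0, 2π), with Fourier coefficients a(n) = (1/(2π)) ∫₀^{2π} f(t) e^{−int} dt, and assume Σ_{n∈ℤ} |a(n) b_m(n)| < ∞ for each m = 1,…,M. Let ε(f, N)² = (L/(2π)) ∫₀^{2π/L} ς(f, N, τ) dτ be the phase-averaged mean square error, where ς(f, N, τ) = (1/(2π)) ∫₀^{2π} | f(t − τ) − T_N f_τ(t) |² dt and T_N f_τ(t) = (1/L) Σ_{m=1}^{M} Σ_{p=0}^{L−1} ( Σ_{n∈ℤ} a(n) b_m(n) e^{−inτ} e^{in t_p} ) y_m(t − t_p). Define Ω_m(L) = max_{i∈I^N} |r_m(i)|². Then ε(f, N)² ≤ Σ_{n∉I^N} |a(n)|² + M · ( Σ_{k=1}^{M} Ω_k(L) ) · Σ_{n∉I^N} Σ_{m=1}^{M} |a(n) b_m(n)|². -/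

import Mathlib

open Real MeasureTheory

/-- The `n`-th Fourier coefficient of a function on `[0, 2π]`. -/
noncomputable def circleCoeff (g : ℝ → ℂ) (n : ℤ) : ℂ :=
  (1 / (2 * (π : ℂ))) *
    ∫ t in (0 : ℝ)..(2 * π), g t * Complex.exp (-Complex.I * (n : ℂ) * (t : ℂ))

lemma circleCoeff_eq_fourierCoeffOn (g : ℝ → ℂ) (n : ℤ) :
    circleCoeff g n = fourierCoeffOn (Real.two_pi_pos) g n := by
  rw [fourierCoeffOn_eq_integral, circleCoeff, Complex.real_smul]
  congr 1
  · simp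
  · refine intervalIntegral.integral_congr fun t _ => ?_
    simp only [smul_eq_mul]
    rw [mul_comm, fourier_coe_apply]
    congr 2
    have := Complex.ofReal_ne_zero.2 Real.pi_ne_zero
    push_cast
    field_simp
    ring

/-- Parseval's identity on `[0, 2π]`. -/
lemma hasSum_sq_circleCoeff {g : ℝ → ℂ} (hg : AEStronglyMeasurable g volume)
    (hg2 : IntervalIntegrable (fun t => ‖g t‖ ^ 2) volume 0 (2 * π)) :
    HasSum (fun n => ‖circleCoeff g n‖ ^ 2)
      (1 / (2 * π) * ∫ t in (0 : ℝ)..(2 * π), ‖g t‖ ^ 2) := by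
  have h : MemLp g 2 (volume.restrict (Set.Ioc 0 (2 * π))) := by
    rw [memLp_two_iff_integrable_sq_norm hg.restrict]
    exact (intervalIntegrable_iff_integrableOn_Ioc_of_le Real.two_pi_pos.le).1 hg2
  simpa [circleCoeff_eq_fourierCoeffOn] using hasSum_sq_fourierCoeffOn Real.two_pi_pos h

lemma integral_exp_int (n : ℤ) :
    (1 / (2 * (π : ℂ))) * ∫ t in (0 : ℝ)..(2 * π), Complex.exp (Complex.I * (n : ℂ) * (t : ℂ)) =
      if n = 0 then 1 else 0 := by
  have hpi := Complex.ofReal_ne_zero.2 Real.pi_ne_zero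
  split_ifs with h
  · subst h
    simp
    field_simp
  · have hc : Complex.I * (n : ℂ) ≠ 0 := mul_ne_zero Complex.I_ne_zero (by exact_mod_cast h)
    rw [integral_exp_mul_complex hc]
    have : Complex.exp (Complex.I * (n : ℂ) * ((2 * π : ℝ) : ℂ)) = 1 := by
      rw [Complex.exp_eq_one_iff]
      exact ⟨n, by push_cast; ring⟩
    rw [this]
    simp

lemma norm_exp_I_int_mul (n : ℤ) (t : ℝ) : ‖Complex.exp (Complex.I * (n : ℂ) * (t : ℂ))‖ = 1 := by
  rw [Complex.norm_exp]; simp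

lemma norm_exp_neg_I_int_mul (n : ℤ) (t : ℝ) :
    ‖Complex.exp (-Complex.I * (n : ℂ) * (t : ℂ))‖ = 1 := by
  rw [Complex.norm_exp]; simp

/-- The coefficients of an absolutely summable trigonometric series are its Fourier coefficients. -/
lemma circleCoeff_tsum {c : ℤ → ℂ} (hc : Summable fun n => ‖c n‖) (m : ℤ) :
    circleCoeff (fun t => ∑' n : ℤ, c n * Complex.exp (Complex.I * (n : ℂ) * (t : ℂ))) m = c m := by
  have key := intervalIntegral.hasSum_integral_of_dominated_convergence (μ := volume)
    (a := 0) (b := 2 * π)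
    (F := fun (n : ℤ) (t : ℝ) => c n * Complex.exp (Complex.I * (n : ℂ) * (t : ℂ)) *
      Complex.exp (-Complex.I * (m : ℂ) * (t : ℂ)))
    (f := fun t => (∑' n : ℤ, c n * Complex.exp (Complex.I * (n : ℂ) * (t : ℂ))) *
      Complex.exp (-Complex.I * (m : ℂ) * (t : ℂ)))
    (fun n _ => ‖c n‖) (fun n => (by fun_prop : Continuous _).aestronglyMeasurable)
    (fun n => ae_of_all _ fun t _ => by
      rw [norm_mul, norm_mul, norm_exp_I_int_mul, norm_exp_neg_I_int_mul, mul_one, mul_one])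
    (ae_of_all _ fun t _ => hc) (by simp)
    (ae_of_all _ fun t _ => by
      refine (Summable.hasSum ?_).mul_right _
      refine Summable.of_norm (hc.congr fun n => ?_)
      rw [norm_mul, norm_exp_I_int_mul, mul_one])
  have hint : ∀ n : ℤ, 1 / (2 * (π : ℂ)) * ∫ t in (0 : ℝ)..(2 * π),
      c n * Complex.exp (Complex.I * (n : ℂ) * (t : ℂ)) *
        Complex.exp (-Complex.I * (m : ℂ) * (t : ℂ)) = if n = m then c n else 0 := by
    intro n
    have h := integral_exp_int (n - m)
    simp only [sub_eq_zero] at h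
    rw [← mul_boole, ← h, mul_left_comm]
    congr 1
    rw [← intervalIntegral.integral_const_mul]
    refine intervalIntegral.integral_congr fun t _ => ?_
    simp only [mul_assoc]
    rw [← Complex.exp_add]
    congr 2
    push_cast
    ring
  have key2 := (key.mul_left (1 / (2 * (π : ℂ)))).tsum_eq
  rw [circleCoeff, ← key2]
  simp only [hint, tsum_ite_eq]

lemma continuous_tsum_mul_exp {c : ℤ → ℂ} (hc : Summable fun n => ‖c n‖) :
    Continuous fun t : ℝ => ∑' n : ℤ, c n * Complex.exp (-Complex.I * (n : ℂ) * (t : ℂ)) := by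
  refine continuous_tsum (fun n => by fun_prop) hc fun n t => ?_
  rw [norm_mul, norm_exp_neg_I_int_mul, mul_one]

lemma hasSum_sq_tsum_mul_exp {c : ℤ → ℂ} (hc : Summable fun n => ‖c n‖) :
    HasSum (fun n => ‖c n‖ ^ 2) (1 / (2 * π) * ∫ t in (0 : ℝ)..(2 * π),
      ‖∑' n : ℤ, c n * Complex.exp (-Complex.I * (n : ℂ) * (t : ℂ))‖ ^ 2) := by
  have hcont := continuous_tsum_mul_exp hc
  have h := hasSum_sq_circleCoeff hcont.aestronglyMeasurable
    (((hcont.norm).pow 2).intervalIntegrable 0 (2 * π))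
  have hneg : ∀ t : ℝ, ∑' n : ℤ, c n * Complex.exp (-Complex.I * (n : ℂ) * (t : ℂ)) =
      ∑' n : ℤ, c (-n) * Complex.exp (Complex.I * (n : ℂ) * (t : ℂ)) := by
    intro t
    rw [← (Equiv.neg ℤ).tsum_eq]
    simp
  have hcoeff : ∀ m, circleCoeff
      (fun t => ∑' n : ℤ, c n * Complex.exp (-Complex.I * (n : ℂ) * (t : ℂ))) m = c (-m) := by
    intro m
    simp only [hneg]
    exact circleCoeff_tsum (c := fun n => c (-n)) ((Equiv.neg ℤ).summable_iff.2 hc) m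
  simp only [hcoeff] at h
  exact (Equiv.neg ℤ).hasSum_iff.1 h

/-- A series whose frequencies lie in one residue class modulo `L` has a `2π / L`-periodic
modulus, so its mean square may be computed over `[0, 2π / L]`. -/
lemma hasSum_sq_tsum_mul_exp_of_modEq {c : ℤ → ℂ} (hc : Summable fun n => ‖c n‖) {L : ℕ}
    (hL : 0 < L) {l : ℤ} (hl : ∀ n, ¬ (L : ℤ) ∣ n - l → c n = 0) :
    HasSum (fun n => ‖c n‖ ^ 2) (L / (2 * π) * ∫ t in (0 : ℝ)..(2 * π / L),
      ‖∑' n : ℤ, c n * Complex.exp (-Complex.I * (n : ℂ) * (t : ℂ))‖ ^ 2) := by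
  have hper : Function.Periodic (fun t : ℝ =>
      ‖∑' n : ℤ, c n * Complex.exp (-Complex.I * (n : ℂ) * (t : ℂ))‖ ^ 2) (2 * π / L) := by
    intro t
    have hL0 : (L : ℂ) ≠ 0 := by exact_mod_cast hL.ne'
    have : ∀ n : ℤ, c n * Complex.exp (-Complex.I * (n : ℂ) * ((t + 2 * π / L : ℝ) : ℂ)) =
        Complex.exp (-Complex.I * (l : ℂ) * ((2 * π / L : ℝ) : ℂ)) *
          (c n * Complex.exp (-Complex.I * (n : ℂ) * (t : ℂ))) := by
      intro n
      by_cases hn : (L : ℤ) ∣ n - l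
      · obtain ⟨k, hk⟩ := hn
        obtain rfl : n = L * k + l := by linarith
        rw [mul_left_comm, ← Complex.exp_add]
        congr 1
        rw [Complex.exp_eq_exp_iff_exists_int]
        refine ⟨-k, ?_⟩
        push_cast
        field_simp
        ring
      · simp [hl n hn]
    simp only [this, tsum_mul_left, norm_mul, norm_exp_neg_I_int_mul, one_mul]
  have h := hper.intervalIntegral_add_zsmul_eq L 0
    fun t₁ t₂ => (((continuous_tsum_mul_exp hc).norm).pow 2).intervalIntegrable t₁ t₂
  have hL0 : (L : ℝ) ≠ 0 := by exact_mod_cast hL.ne'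
  convert hasSum_sq_tsum_mul_exp hc using 1
  have e : 0 + (L : ℤ) • (2 * π / L) = 2 * π := by simp; field_simp
  rw [e] at h
  rw [h, zero_add, zsmul_eq_mul]
  push_cast
  ring

lemma circleCoeff_comp_sub {g : ℝ → ℂ} (hg : ∀ t, g (t + 2 * π) = g t) (τ : ℝ) (n : ℤ) :
    circleCoeff (fun t => g (t - τ)) n =
      circleCoeff g n * Complex.exp (-Complex.I * (n : ℂ) * (τ : ℂ)) := by
  have hper : Function.Periodic
      (fun t : ℝ => g t * Complex.exp (-Complex.I * (n : ℂ) * (t : ℂ))) (2 * π) := by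
    intro t
    simp only [hg]
    congr 1
    rw [Complex.exp_eq_exp_iff_exists_int]
    exact ⟨-n, by push_cast; ring⟩
  have h := intervalIntegral.integral_comp_sub_right (a := 0) (b := 2 * π)
    (fun t : ℝ => g t * Complex.exp (-Complex.I * (n : ℂ) * (t : ℂ))) τ
  rw [zero_sub, show 2 * π - τ = -τ + 2 * π by ring, hper.intervalIntegral_add_eq (-τ) 0,
    zero_add] at h
  rw [circleCoeff, circleCoeff, mul_assoc, ← h, ← intervalIntegral.integral_mul_const]
  congr 1
  refine intervalIntegral.integral_congr fun t _ => ?_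
  simp only [mul_assoc]
  rw [← Complex.exp_add]
  congr 2
  push_cast
  ring

/-- Orthogonality of the characters of `ℤ / L`. -/
lemma sum_exp_range (L : ℕ) (hL : 0 < L) (n : ℤ) :
    (1 / (L : ℂ)) * ∑ p ∈ Finset.range L,
      Complex.exp (Complex.I * (n : ℂ) * ((2 * π * p / L : ℝ) : ℂ)) =
      if (L : ℤ) ∣ n then 1 else 0 := by
  have hL0 : (L : ℂ) ≠ 0 := by exact_mod_cast hL.ne'
  have hpi := Complex.ofReal_ne_zero.2 Real.pi_ne_zero
  set z := Complex.exp (Complex.I * (n : ℂ) * ((2 * π / L : ℝ) : ℂ)) with hz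
  have hp : ∀ p : ℕ, Complex.exp (Complex.I * (n : ℂ) * ((2 * π * p / L : ℝ) : ℂ)) = z ^ p := by
    intro p
    rw [hz, ← Complex.exp_nat_mul]
    congr 1
    push_cast
    ring
  have hz1 : z = 1 ↔ (L : ℤ) ∣ n := by
    rw [hz, Complex.exp_eq_one_iff]
    constructor
    · rintro ⟨k, hk⟩
      refine ⟨k, ?_⟩
      push_cast at hk
      have hI := Complex.I_ne_zero
      field_simp at hk
      exact_mod_cast hk
    · rintro ⟨k, rfl⟩
      refine ⟨k, ?_⟩
      push_cast
      field_simp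
  have hzL : z ^ L = 1 := by
    rw [← hp, Complex.exp_eq_one_iff]
    refine ⟨n, ?_⟩
    push_cast
    field_simp
  simp only [hp]
  split_ifs with h
  · rw [hz1.2 h]
    simp [hL0]
  · rw [geom_sum_eq (fun h' => h (hz1.1 h')), hzL]
    simp

lemma card_filter_dvd_sub_le {N₁ N₂ : ℤ} {M L : ℕ} (hL : 0 < L)
    (h : N₂ - N₁ + 1 = (L : ℤ) * (M : ℤ)) (n : ℤ) :
    ((Finset.Icc N₁ N₂).filter fun l => (L : ℤ) ∣ n - l).card ≤ M := by
  have hL' : (0 : ℤ) < L := by exact_mod_cast hL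
  have := Finset.card_le_card_of_injOn (s := (Finset.Icc N₁ N₂).filter fun l => (L : ℤ) ∣ n - l)
    (t := Finset.Ico (0 : ℤ) M) (fun l => (l - N₁) / L) ?_ ?_
  · simpa using this
  · intro l hl
    simp only [Finset.coe_filter, Finset.mem_Icc, Set.mem_ofPred_eq] at hl
    simp only [Finset.coe_Ico, Set.mem_Ico]
    exact ⟨Int.ediv_nonneg (by linarith [hl.1.1]) hL'.le,
      Int.ediv_lt_of_lt_mul hL' (by linarith [hl.1.2])⟩
  · intro l hl l' hl' hll
    simp only [Finset.coe_filter, Finset.mem_Icc, Set.mem_ofPred_eq] at hl hl'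
    have hd : (L : ℤ) ∣ (l - N₁) - (l' - N₁) := by
      rw [show (l - N₁) - (l' - N₁) = (n - l') - (n - l) by ring]
      exact dvd_sub hl'.2 hl.2
    have h1 : (l - N₁) % L = (l' - N₁) % L :=
      Int.emod_eq_emod_iff_emod_sub_eq_zero.2 (Int.emod_eq_zero_of_dvd hd)
    have h2 := Int.emod_add_mul_ediv (l - N₁) L
    have h3 := Int.emod_add_mul_ediv (l' - N₁) L
    simp only at hll
    rw [hll, h1, h3] at h2
    linarith

lemma circleCoeff_sub {g h : ℝ → ℂ} (hg : IntervalIntegrable g volume 0 (2 * π))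
    (hh : IntervalIntegrable h volume 0 (2 * π)) (n : ℤ) :
    circleCoeff (fun t => g t - h t) n = circleCoeff g n - circleCoeff h n := by
  have hc : ContinuousOn (fun t : ℝ => Complex.exp (-Complex.I * (n : ℂ) * (t : ℂ)))
      (Set.uIcc 0 (2 * π)) := by fun_prop
  rw [circleCoeff, circleCoeff, circleCoeff, ← mul_sub,
    ← intervalIntegral.integral_sub (hg.mul_continuousOn hc) (hh.mul_continuousOn hc)]
  simp only [sub_mul]

lemma circleCoeff_sum_exp (s : Finset ℤ) (C : ℤ → ℂ) (n : ℤ) :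
    circleCoeff (fun t => ∑ l ∈ s, C l * Complex.exp (Complex.I * (l : ℂ) * (t : ℂ))) n =
      if n ∈ s then C n else 0 := by
  have hs : Summable fun l => ‖if l ∈ s then C l else 0‖ :=
    summable_of_ne_finset_zero (s := s) fun l hl => by simp [hl]
  rw [← circleCoeff_tsum hs n]
  congr 1
  funext t
  rw [tsum_eq_sum (s := s) fun l hl => by simp [hl]]
  exact Finset.sum_congr rfl fun l hl => by simp [hl]

/-- The mean square distance of a translate of `f` to a trigonometric polynomial. -/
lemma mean_sq_sub_sum_exp {f : ℝ → ℂ} (hper : ∀ t, f (t + 2 * π) = f t)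
    (hmeas : AEStronglyMeasurable f volume)
    (hL2 : IntervalIntegrable (fun t : ℝ => ‖f t‖ ^ 2) volume 0 (2 * π))
    (s : Finset ℤ) (C : ℤ → ℂ) (τ : ℝ) :
    (1 / (2 * π)) * ∫ t in (0 : ℝ)..(2 * π),
      ‖f (t - τ) - ∑ l ∈ s, C l * Complex.exp (Complex.I * (l : ℂ) * (t : ℂ))‖ ^ 2 =
    (∑' n : ℤ, if n ∈ s then 0 else ‖circleCoeff f n‖ ^ 2) +
      ∑ l ∈ s, ‖C l - circleCoeff f l * Complex.exp (-Complex.I * (l : ℂ) * (τ : ℂ))‖ ^ 2 := by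
  have hfm : AEStronglyMeasurable (fun t => f (t - τ)) volume :=
    hmeas.comp_measurePreserving (measurePreserving_sub_right volume τ)
  have hper2 : Function.Periodic (fun t => ‖f t‖ ^ 2) (2 * π) := fun t => by simp only [hper]
  have hf2 : IntervalIntegrable (fun t => ‖f (t - τ)‖ ^ 2) volume 0 (2 * π) := by
    have := (hper2.intervalIntegrable₀ Real.two_pi_pos.ne' hL2 (0 - τ) (2 * π - τ)).comp_sub_right τ
    simpa using this
  set P : ℝ → ℂ := fun t => ∑ l ∈ s, C l * Complex.exp (Complex.I * (l : ℂ) * (t : ℂ)) with hP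
  have hPc : Continuous P := by fun_prop
  have hmem : MemLp (fun t => f (t - τ)) 2 (volume.restrict (Set.Ioc 0 (2 * π))) := by
    rw [memLp_two_iff_integrable_sq_norm hfm.restrict]
    exact (intervalIntegrable_iff_integrableOn_Ioc_of_le Real.two_pi_pos.le).1 hf2
  have hPmem : MemLp P 2 (volume.restrict (Set.Ioc 0 (2 * π))) := by
    rw [memLp_two_iff_integrable_sq_norm hPc.aestronglyMeasurable]
    exact (intervalIntegrable_iff_integrableOn_Ioc_of_le Real.two_pi_pos.le).1
      ((hPc.norm.pow 2).intervalIntegrable _ _)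
  have hfi : IntervalIntegrable (fun t => f (t - τ)) volume 0 (2 * π) :=
    (intervalIntegrable_iff_integrableOn_Ioc_of_le Real.two_pi_pos.le).2
      (hmem.integrable one_le_two)
  have hd2 : IntervalIntegrable (fun t => ‖f (t - τ) - P t‖ ^ 2) volume 0 (2 * π) :=
    (intervalIntegrable_iff_integrableOn_Ioc_of_le Real.two_pi_pos.le).2
      ((memLp_two_iff_integrable_sq_norm (hmem.sub hPmem).1).1 (hmem.sub hPmem))
  have h := hasSum_sq_circleCoeff (hfm.sub hPc.aestronglyMeasurable) hd2
  have hout : Summable fun n : ℤ => if n ∈ s then 0 else ‖circleCoeff f n‖ ^ 2 := by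
    refine Summable.of_nonneg_of_le (fun n => ?_) (fun n => ?_)
      (hasSum_sq_circleCoeff hmeas hL2).summable
    · split_ifs <;> positivity
    · split_ifs
      · positivity
      · exact le_rfl
  have hin : HasSum (fun n : ℤ => if n ∈ s then
      ‖C n - circleCoeff f n * Complex.exp (-Complex.I * (n : ℂ) * (τ : ℂ))‖ ^ 2 else 0)
      (∑ l ∈ s, ‖C l - circleCoeff f l * Complex.exp (-Complex.I * (l : ℂ) * (τ : ℂ))‖ ^ 2) := by
    have := hasSum_sum_of_ne_finset_zero (L := .unconditional ℤ) (s := s)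
      (f := fun n : ℤ => if n ∈ s then
      ‖C n - circleCoeff f n * Complex.exp (-Complex.I * (n : ℂ) * (τ : ℂ))‖ ^ 2 else 0)
      fun n hn => by simp [hn]
    rwa [Finset.sum_congr rfl fun l hl => if_pos hl] at this
  have hcoeff : (fun n => ‖circleCoeff (fun t => f (t - τ) - P t) n‖ ^ 2) = fun n : ℤ =>
      (if n ∈ s then 0 else ‖circleCoeff f n‖ ^ 2) + if n ∈ s then
      ‖C n - circleCoeff f n * Complex.exp (-Complex.I * (n : ℂ) * (τ : ℂ))‖ ^ 2 else 0 := by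
    funext n
    have hc : circleCoeff (fun t => f (t - τ) - P t) n = circleCoeff f n *
        Complex.exp (-Complex.I * (n : ℂ) * (τ : ℂ)) - if n ∈ s then C n else 0 := by
      rw [circleCoeff_sub hfi (hPc.intervalIntegrable _ _), circleCoeff_comp_sub hper,
        circleCoeff_sum_exp]
    rw [hc]
    split_ifs
    · rw [zero_add, norm_sub_rev]
    · rw [sub_zero, add_zero, norm_mul, norm_exp_neg_I_int_mul, mul_one]
  rw [← (hout.hasSum.add hin).tsum_eq, ← hcoeff]
  exact h.tsum_eq.symm

/-- Biorthogonality of the channel coefficients and the entries of the inverse matrices within the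
band. -/
lemma sum_channel_mul_inverse_entry {N₁ N₂ : ℤ} {M L : ℕ} (hL : 0 < L)
    (hNML : N₂ - N₁ + 1 = (L : ℤ) * (M : ℤ)) {b : Fin M → ℤ → ℂ}
    {H : ℤ → Matrix (Fin M) (Fin M) ℂ}
    (hH : ∀ n : ℤ, H n = Matrix.of fun j k : Fin M => b k (n + (j : ℤ) * (L : ℤ)))
    (hinv : ∀ n : ℤ, N₁ ≤ n → n ≤ N₁ + (L : ℤ) - 1 → IsUnit (H n))
    {r : Fin M → ℤ → ℂ}
    (hr1 : ∀ (m : Fin M) (n : ℤ), N₁ ≤ n → n ≤ N₁ + (L : ℤ) - 1 →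
      ∀ k : Fin M, r m (n + (k : ℤ) * (L : ℤ)) = (H n)⁻¹ m k)
    {n l : ℤ} (hn : n ∈ Finset.Icc N₁ N₂) (hl : l ∈ Finset.Icc N₁ N₂) (hd : (L : ℤ) ∣ n - l) :
    ∑ m, b m n * r m l = if n = l then 1 else 0 := by
  have hL' : (0 : ℤ) < L := by exact_mod_cast hL
  have hblock : ∀ i ∈ Finset.Icc N₁ N₂,
      ∃ j : Fin M, i = (N₁ + (i - N₁) % L) + (j : ℤ) * L := by
    intro i hi
    rw [Finset.mem_Icc] at hi
    have h0 : 0 ≤ (i - N₁) / L := Int.ediv_nonneg (by linarith) hL'.le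
    have h1 : (i - N₁) / L < M := Int.ediv_lt_of_lt_mul hL' (by linarith)
    refine ⟨⟨((i - N₁) / L).toNat, by omega⟩, ?_⟩
    have h2 := Int.emod_add_mul_ediv (i - N₁) L
    simp only [Int.toNat_of_nonneg h0]
    linarith
  obtain ⟨j, hj⟩ := hblock n hn
  obtain ⟨k, hk⟩ := hblock l hl
  have hres : (l - N₁) % L = (n - N₁) % L := by
    refine (Int.emod_eq_emod_iff_emod_sub_eq_zero.2 (Int.emod_eq_zero_of_dvd ?_)).symm
    rwa [show n - N₁ - (l - N₁) = n - l by ring]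
  rw [hres] at hk
  have hlo : N₁ ≤ N₁ + (n - N₁) % L := by linarith [Int.emod_nonneg (n - N₁) hL'.ne']
  have hhi : N₁ + (n - N₁) % L ≤ N₁ + L - 1 := by linarith [Int.emod_lt_of_pos (n - N₁) hL']
  generalize N₁ + (n - N₁) % L = n₀ at hj hk hlo hhi
  have hmul := congrFun (congrFun (Matrix.mul_nonsing_inv (H n₀)
    ((Matrix.isUnit_iff_isUnit_det _).1 (hinv n₀ hlo hhi))) j) k
  rw [Matrix.mul_apply, Matrix.one_apply] at hmul
  have hjk : n = l ↔ j = k := by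
    rw [hj, hk, add_right_inj, mul_left_inj' hL'.ne']
    exact ⟨fun h => Fin.ext (by exact_mod_cast h), fun h => by rw [h]⟩
  simp only [hjk]
  rw [← hmul]
  refine Finset.sum_congr rfl fun m _ => ?_
  rw [hk, hr1 m n₀ hlo hhi k, hj, hH n₀, Matrix.of_apply]

lemma summable_norm_channel {M : ℕ} {a : ℤ → ℂ} {b : Fin M → ℤ → ℂ}
    (hsum : ∀ m : Fin M, Summable fun n : ℤ => ‖a n * b m n‖) (w : Fin M → ℂ)
    (P : ℤ → Prop) [DecidablePred P] :
    Summable fun n : ℤ => ‖if P n then a n * ∑ m, b m n * w m else 0‖ := by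
  refine Summable.of_nonneg_of_le (fun n => norm_nonneg _) (fun n => ?_)
    (summable_sum fun m (_ : m ∈ Finset.univ) => (hsum m).mul_right ‖w m‖)
  split_ifs
  · rw [Finset.mul_sum]
    refine (norm_sum_le _ _).trans (Finset.sum_le_sum fun m _ => ?_)
    rw [← mul_assoc, norm_mul _ (w m)]
  · rw [norm_zero]
    positivity

/-- The sampling series is a trigonometric polynomial whose coefficients are aliasing series over
residue classes modulo `L`. -/
lemma generalized_sampling_eq_sum_exp {M L : ℕ} (hL : 0 < L) (s : Finset ℤ) {a : ℤ → ℂ}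
    {b r : Fin M → ℤ → ℂ} (hsum : ∀ m : Fin M, Summable fun n : ℤ => ‖a n * b m n‖)
    {y : Fin M → ℝ → ℂ}
    (hy : ∀ (m : Fin M) (t : ℝ),
      y m t = ∑ n ∈ s, r m n * Complex.exp (Complex.I * (n : ℂ) * (t : ℂ))) (τ t : ℝ) :
    (1 / (L : ℂ)) * ∑ m : Fin M, ∑ p ∈ Finset.range L,
      (∑' n : ℤ, a n * b m n * Complex.exp (-Complex.I * (n : ℂ) * (τ : ℂ)) *
        Complex.exp (Complex.I * (n : ℂ) * ((2 * π * p / L : ℝ) : ℂ))) *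
      y m (t - 2 * π * p / L) =
    ∑ l ∈ s, (∑' n : ℤ, (if (L : ℤ) ∣ n - l then a n * ∑ m, b m n * r m l else 0) *
      Complex.exp (-Complex.I * (n : ℂ) * (τ : ℂ))) *
      Complex.exp (Complex.I * (l : ℂ) * (t : ℂ)) := by
  have hA : ∀ (m : Fin M) (p : ℕ), Summable fun n : ℤ =>
      a n * b m n * Complex.exp (-Complex.I * (n : ℂ) * (τ : ℂ)) *
        Complex.exp (Complex.I * (n : ℂ) * ((2 * π * p / L : ℝ) : ℂ)) := by
    intro m p
    refine Summable.of_norm ((hsum m).congr fun n => ?_)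
    rw [norm_mul _ (Complex.exp _), norm_mul _ (Complex.exp _), norm_exp_I_int_mul,
      norm_exp_neg_I_int_mul, mul_one, mul_one]
  have hB : ∀ l : ℤ, Summable fun n : ℤ =>
      (if (L : ℤ) ∣ n - l then a n * ∑ m, b m n * r m l else 0) *
      Complex.exp (-Complex.I * (n : ℂ) * (τ : ℂ)) := by
    intro l
    refine Summable.of_norm ((summable_norm_channel hsum (fun m => r m l)
      fun n => (L : ℤ) ∣ n - l).congr fun n => ?_)
    rw [norm_mul _ (Complex.exp _), norm_exp_neg_I_int_mul, mul_one]
  have h1 := HasSum.mul_left (1 / (L : ℂ)) (hasSum_sum (s := Finset.univ) fun m _ =>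
    hasSum_sum (s := Finset.range L) fun p _ =>
      (hA m p).hasSum.mul_right (y m (t - 2 * π * p / L)))
  have h2 := hasSum_sum (s := s) fun l _ =>
    (hB l).hasSum.mul_right (Complex.exp (Complex.I * (l : ℂ) * (t : ℂ)))
  rw [← h1.tsum_eq, ← h2.tsum_eq]
  refine tsum_congr fun n => ?_
  have hexp : ∀ (l : ℤ) (p : ℕ),
      Complex.exp (Complex.I * (n : ℂ) * ((2 * π * p / L : ℝ) : ℂ)) *
        Complex.exp (Complex.I * (l : ℂ) * ((t - 2 * π * p / L : ℝ) : ℂ)) =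
      Complex.exp (Complex.I * (l : ℂ) * (t : ℂ)) *
        Complex.exp (Complex.I * ((n - l : ℤ) : ℂ) * ((2 * π * p / L : ℝ) : ℂ)) := by
    intro l p
    rw [← Complex.exp_add, ← Complex.exp_add]
    congr 1
    push_cast
    ring
  calc _ = ∑ l ∈ s, a n * (∑ m, b m n * r m l) *
        Complex.exp (-Complex.I * (n : ℂ) * (τ : ℂ)) *
        Complex.exp (Complex.I * (l : ℂ) * (t : ℂ)) * ((1 / (L : ℂ)) * ∑ p ∈ Finset.range L,
          Complex.exp (Complex.I * ((n - l : ℤ) : ℂ) * ((2 * π * p / L : ℝ) : ℂ))) := by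
        simp only [hy, Finset.mul_sum, Finset.sum_mul]
        rw [Finset.sum_congr rfl fun m _ => Finset.sum_comm, Finset.sum_comm]
        refine Finset.sum_congr rfl fun l _ => ?_
        rw [Finset.sum_comm]
        refine Finset.sum_congr rfl fun p _ => Finset.sum_congr rfl fun m _ => ?_
        linear_combination (1 / (L : ℂ) * a n * b m n * r m l *
          Complex.exp (-Complex.I * (n : ℂ) * (τ : ℂ))) * hexp l p
    _ = _ := by
        refine Finset.sum_congr rfl fun l _ => ?_
        rw [sum_exp_range L hL]
        split_ifs <;> simp

lemma norm_sq_mul_sum_le {M : ℕ} (α : ℂ) (u w : Fin M → ℂ) :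
    ‖α * ∑ m, u m * w m‖ ^ 2 ≤ (∑ m, ‖w m‖ ^ 2) * ∑ m, ‖α * u m‖ ^ 2 := by
  rw [Finset.mul_sum]
  calc _ ≤ (∑ m, ‖α * u m‖ * ‖w m‖) ^ 2 := by
        gcongr
        refine (norm_sum_le _ _).trans_eq (Finset.sum_congr rfl fun m _ => ?_)
        rw [← mul_assoc, norm_mul _ (w m)]
    _ ≤ _ := by
        rw [mul_comm]
        exact Finset.sum_mul_sq_le_sq_mul_sq _ _ _

/-- The error estimate (33): the phase-averaged mean square error of the MCI
approximation is bounded via `Ω_m(L) = max_{i∈I^N} |r_m(i)|²` and the out-of-band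
energy of the channel coefficients. -/
theorem mci_averaged_error_bound
    (N₁ N₂ : ℤ) (M L : ℕ) (hM : 0 < M) (hL : 0 < L)
    (hNML : N₂ - N₁ + 1 = (L : ℤ) * (M : ℤ))
    (b : Fin M → ℤ → ℂ)
    (H : ℤ → Matrix (Fin M) (Fin M) ℂ)
    (hH : ∀ n : ℤ, H n = Matrix.of fun j k : Fin M => b k (n + (j : ℤ) * (L : ℤ)))
    (hinv : ∀ n : ℤ, N₁ ≤ n → n ≤ N₁ + (L : ℤ) - 1 → IsUnit (H n))
    (r : Fin M → ℤ → ℂ)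
    (hr1 : ∀ (m : Fin M) (n : ℤ), N₁ ≤ n → n ≤ N₁ + (L : ℤ) - 1 →
      ∀ k : Fin M, r m (n + (k : ℤ) * (L : ℤ)) = (H n)⁻¹ m k)
    (hr0 : ∀ (m : Fin M) (n : ℤ), n < N₁ ∨ N₂ < n → r m n = 0)
    (y : Fin M → ℝ → ℂ)
    (hy : ∀ (m : Fin M) (t : ℝ),
      y m t = ∑ n ∈ Finset.Icc N₁ N₂, r m n * Complex.exp (Complex.I * (n : ℂ) * (t : ℂ)))
    (f : ℝ → ℂ)
    (hper : ∀ t : ℝ, f (t + 2 * π) = f t)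
    (hmeas : AEStronglyMeasurable f volume)
    (hL2 : IntervalIntegrable (fun t : ℝ => ‖f t‖ ^ 2) volume 0 (2 * π))
    (a : ℤ → ℂ)
    (ha : ∀ n : ℤ, a n = (1 / (2 * (π : ℂ))) *
      ∫ t in (0 : ℝ)..(2 * π), f t * Complex.exp (-Complex.I * (n : ℂ) * (t : ℂ)))
    (hsum : ∀ m : Fin M, Summable fun n : ℤ => ‖a n * b m n‖)
    (T : ℝ → ℝ → ℂ)
    (hT : ∀ (τ t : ℝ), T τ t = (1 / (L : ℂ)) * ∑ m : Fin M, ∑ p ∈ Finset.range L,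
      (∑' n : ℤ, a n * b m n * Complex.exp (-Complex.I * (n : ℂ) * (τ : ℂ)) *
        Complex.exp (Complex.I * (n : ℂ) * ((2 * π * p / L : ℝ) : ℂ))) *
      y m (t - 2 * π * p / L))
    (ς : ℝ → ℝ)
    (hς : ∀ τ : ℝ, ς τ = (1 / (2 * π)) *
      ∫ t in (0 : ℝ)..(2 * π), ‖f (t - τ) - T τ t‖ ^ 2)
    (Ω : Fin M → ℝ)
    (hΩ : ∀ m : Fin M,
      IsGreatest ((fun i : ℤ => ‖r m i‖ ^ 2) '' (Set.Icc N₁ N₂)) (Ω m)) :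
    ((L : ℝ) / (2 * π)) * ∫ τ in (0 : ℝ)..(2 * π / L), ς τ ≤
      (∑' n : ℤ, if n ∈ Finset.Icc N₁ N₂ then 0 else ‖a n‖ ^ 2) +
      (M : ℝ) * (∑ k : Fin M, Ω k) *
        ∑' n : ℤ, if n ∈ Finset.Icc N₁ N₂ then 0 else
          ∑ m : Fin M, ‖a n * b m n‖ ^ 2 := by
  obtain rfl : a = circleCoeff f := funext ha
  set s := Finset.Icc N₁ N₂ with hs
  set e : ℤ → ℤ → ℂ := fun l n => if n ∉ s ∧ (L : ℤ) ∣ n - l then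
    circleCoeff f n * ∑ m, b m n * r m l else 0 with he
  set G : ℤ → ℝ → ℂ := fun l τ =>
    ∑' n : ℤ, e l n * Complex.exp (-Complex.I * (n : ℂ) * (τ : ℂ)) with hG
  have hes : ∀ l, Summable fun n => ‖e l n‖ := fun l =>
    summable_norm_channel hsum (fun m => r m l) fun n => n ∉ s ∧ (L : ℤ) ∣ n - l
  have hGc : ∀ l, Continuous (G l) := fun l => continuous_tsum_mul_exp (hes l)
  have hcoeff : ∀ l ∈ s, ∀ τ : ℝ,
      (∑' n : ℤ, (if (L : ℤ) ∣ n - l then circleCoeff f n * ∑ m, b m n * r m l else 0) *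
        Complex.exp (-Complex.I * (n : ℂ) * (τ : ℂ))) -
      circleCoeff f l * Complex.exp (-Complex.I * (l : ℂ) * (τ : ℂ)) = G l τ := by
    intro l hl τ
    have h1 : Summable fun n : ℤ => e l n * Complex.exp (-Complex.I * (n : ℂ) * (τ : ℂ)) :=
      Summable.of_norm ((hes l).congr fun n => by
        rw [norm_mul _ (Complex.exp _), norm_exp_neg_I_int_mul, mul_one])
    have h2 := h1.hasSum.add (hasSum_ite_eq l
      (circleCoeff f l * Complex.exp (-Complex.I * (l : ℂ) * (τ : ℂ))))
    rw [sub_eq_iff_eq_add, ← h2.tsum_eq]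
    refine tsum_congr fun n => ?_
    by_cases hd : (L : ℤ) ∣ n - l
    · by_cases hn : n ∈ s
      · have := sum_channel_mul_inverse_entry hL hNML hH hinv hr1 hn hl hd
        simp only [he, hn, hd, this]
        by_cases hnl : n = l
        · subst hnl; simp
        · simp [hnl]
      · have hnl : n ≠ l := fun h => hn (h ▸ hl)
        simp [he, hn, hd, hnl]
    · have hnl : n ≠ l := fun h => hd (by simp [h])
      simp [he, hd, hnl]
  have hςG : ∀ τ, ς τ =
      (∑' n : ℤ, if n ∈ s then 0 else ‖circleCoeff f n‖ ^ 2) + ∑ l ∈ s, ‖G l τ‖ ^ 2 := by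
    intro τ
    rw [hς]
    simp only [hT, generalized_sampling_eq_sum_exp hL s hsum hy]
    rw [mean_sq_sub_sum_exp hper hmeas hL2]
    congr 1
    exact Finset.sum_congr rfl fun l hl => by rw [hcoeff l hl]
  have hmean : ∀ l, HasSum (fun n => ‖e l n‖ ^ 2)
      (L / (2 * π) * ∫ τ in (0 : ℝ)..(2 * π / L), ‖G l τ‖ ^ 2) := fun l =>
    hasSum_sq_tsum_mul_exp_of_modEq (hes l) hL (l := l) fun n hn => by simp [he, hn]
  have hG2 : ∀ l, Continuous fun τ => ‖G l τ‖ ^ 2 := fun l => (hGc l).norm.pow 2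
  have hLpos : (0 : ℝ) < L := by exact_mod_cast hL
  simp only [hςG]
  rw [intervalIntegral.integral_add (by simp)
      ((continuous_finsetSum s fun l _ => hG2 l).intervalIntegrable _ _),
    intervalIntegral.integral_finsetSum
      fun l _ => (hG2 l).intervalIntegrable _ _,
    intervalIntegral.integral_const, mul_add, Finset.mul_sum]
  have hone : ∀ A : ℝ, (L : ℝ) / (2 * π) * ((2 * π / L - 0) • A) = A := by
    intro A
    rw [smul_eq_mul]
    field_simp
    ring
  rw [hone]
  gcongr
  have hb2 : Summable fun n : ℤ => if n ∈ s then 0 else ∑ m, ‖circleCoeff f n * b m n‖ ^ 2 := by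
    have hsq : Summable fun n : ℤ => ∑ m, ‖circleCoeff f n * b m n‖ ^ 2 :=
      summable_sum fun m _ => (hasSum_sq_tsum_mul_exp (hsum m).of_norm.norm).summable
    refine Summable.of_nonneg_of_le (fun n => ?_) (fun n => ?_) hsq
    · split_ifs <;> positivity
    · split_ifs
      · positivity
      · exact le_rfl
  rw [← (hasSum_sum fun l _ => hmean l).tsum_eq, ← tsum_mul_left]
  refine Summable.tsum_le_tsum (fun n => ?_) (hasSum_sum fun l _ => hmean l).summable
    (hb2.mul_left _)
  split_ifs with hn
  · simp [he, hn]
  have hr : ∀ l ∈ s, ∑ m, ‖r m l‖ ^ 2 ≤ ∑ m, Ω m := fun l hl =>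
    Finset.sum_le_sum fun m _ => (hΩ m).2 ⟨l, by simpa [hs] using hl, rfl⟩
  have hΩ0 : 0 ≤ ∑ m, Ω m := Finset.sum_nonneg fun m _ => by
    obtain ⟨i, _, hi⟩ := (hΩ m).1
    rw [← hi]
    positivity
  calc ∑ l ∈ s, ‖e l n‖ ^ 2
      = ∑ l ∈ s with (L : ℤ) ∣ n - l, ‖circleCoeff f n * ∑ m, b m n * r m l‖ ^ 2 := by
        rw [Finset.sum_filter]
        refine Finset.sum_congr rfl fun l _ => ?_
        by_cases hd : (L : ℤ) ∣ n - l <;> simp [he, hn, hd]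
    _ ≤ ∑ l ∈ s with (L : ℤ) ∣ n - l,
          (∑ m, Ω m) * ∑ m, ‖circleCoeff f n * b m n‖ ^ 2 := by
        refine Finset.sum_le_sum fun l hl => ?_
        refine (norm_sq_mul_sum_le _ _ _).trans ?_
        gcongr ?_ * _
        exact hr l (Finset.mem_filter.1 hl).1
    _ ≤ (M : ℝ) * (∑ m, Ω m) * ∑ m, ‖circleCoeff f n * b m n‖ ^ 2 := by
        rw [Finset.sum_const, nsmul_eq_mul, mul_assoc]
        gcongr
        exact card_filter_dvd_sub_le hL hNML n
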